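/- arXiv:1101.2932 — 2 statements merged into one kernel-verified Lean document; each statement's English description precedes it below -/
import Mathlib

section
/- Let a<b, α,β ∈ (0,1), γ ∈ [0,1], N ∈ ℕ, L ∈ C¹([a,b]×ℝ^{3N};ℝ), l ∈ {1,…,N}, y^a ∈ ℝ^N, y_i^b ∈ ℝ for i ≠ l, and y_l^b ∈ ℝ. Suppose y ∈ D is a local minimizer of J(y) = ∫_a^b L[y](x) dx among all functions in D satisfying y(a)=y^a, y_i(b)=y_i^b for all i ≠ l, and y_l(b) ≤ y_l^b, and assume that for each i = 2,…,N+1 the function x ↦ ∂_{N+i}L[y](x) is continuously differentiable on [a,b] and x ↦ ∂_{2N+i}L[y](x) admits continuous Riemann–Liouville derivatives ₐD_x^β and ₓD_b^α on [a,b]. Then y satisfies the Euler–Lagrange equations ∂_iL[y](x) − (d/dx)∂_{N+i}L[y](x) + (D^{β,α}_{1−γ} ∂_{2N+i}L[y])(x) = 0 for i = 2,…,N+1 and all x ∈ [a,b], together with the transversality condition [ ∂_{N+l+1}L[y](x) + γ(ₓI_b^{1−α} ∂_{2N+l+1}L[y])(x) − (1−γ)(ₐI_x^{1−β} ∂_{2N+l+1}L[y])(x)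 ]_{x=b} ≤ 0, with equality holding whenever y_l(b) < y_l^b. -/
open MeasureTheory Set

noncomputable section

/-- Left Riemann–Liouville fractional integral of order `α` with lower limit `a`. -/
def leftRLI (a α : ℝ) (f : ℝ → ℝ) (x : ℝ) : ℝ :=
  (1 / Real.Gamma α) * ∫ t in a..x, (x - t) ^ (α - 1) * f t

/-- Right Riemann–Liouville fractional integral of order `α` with upper limit `b`. -/
def rightRLI (b α : ℝ) (f : ℝ → ℝ) (x : ℝ) : ℝ :=
  (1 / Real.Gamma α) * ∫ t in x..b, (t - x) ^ (α - 1) * f t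

/-- Left Caputo fractional derivative of order `α`. -/
def caputoL (a α : ℝ) (f : ℝ → ℝ) (x : ℝ) : ℝ :=
  (1 / Real.Gamma (1 - α)) * ∫ t in a..x, (x - t) ^ (-α) * deriv f t

/-- Right Caputo fractional derivative of order `α`. -/
def caputoR (b α : ℝ) (f : ℝ → ℝ) (x : ℝ) : ℝ :=
  (-1 / Real.Gamma (1 - α)) * ∫ t in x..b, (t - x) ^ (-α) * deriv f t

/-- Combined Caputo fractional derivative `^C D^{α,β}_γ`. -/
def combCaputo (a b α β γ : ℝ) (f : ℝ → ℝ) (x : ℝ) : ℝ :=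
  γ * caputoL a α f x + (1 - γ) * caputoR b β f x

/-- Left Riemann–Liouville fractional derivative of order `α`. -/
def leftRLD (a α : ℝ) (g : ℝ → ℝ) (x : ℝ) : ℝ :=
  (1 / Real.Gamma (1 - α)) * deriv (fun s => ∫ t in a..s, (s - t) ^ (-α) * g t) x

/-- Right Riemann–Liouville fractional derivative of order `α`. -/
def rightRLD (b α : ℝ) (g : ℝ → ℝ) (x : ℝ) : ℝ :=
  (-1 / Real.Gamma (1 - α)) * deriv (fun s => ∫ t in s..b, (t - s) ^ (-α) * g t) x

/-- Combined Riemann–Liouville derivative `D^{β,α}_{1-γ} = (1-γ) ₐD_x^β + γ ₓD_b^α`. -/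
def combRLD (a b β α γ : ℝ) (g : ℝ → ℝ) (x : ℝ) : ℝ :=
  (1 - γ) * leftRLD a β g x + γ * rightRLD b α g x

/-- Componentwise combined Caputo derivative of a vector-valued function. -/
def combCaputoVec (a b α β γ : ℝ) {N : ℕ} (y : ℝ → Fin N → ℝ) (x : ℝ) : Fin N → ℝ :=
  fun i => combCaputo a b α β γ (fun t => y t i) x

/-- The class `D`: `y'` and `^C D^{α,β}_γ y` exist and are continuous on `[a,b]`. -/
def MemD (a b α β γ : ℝ) {N : ℕ} (y : ℝ → Fin N → ℝ) : Prop :=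
  (∀ x ∈ Icc a b, DifferentiableAt ℝ y x) ∧
  ContinuousOn (deriv y) (Icc a b) ∧
  ContinuousOn (combCaputoVec a b α β γ y) (Icc a b)

/-- The norm `‖·‖_{1,∞}` on `D`. -/
def norm1inf (a b α β γ : ℝ) {N : ℕ} (y : ℝ → Fin N → ℝ) : ℝ :=
  sSup ((fun x => ‖y x‖) '' Icc a b) + sSup ((fun x => ‖deriv y x‖) '' Icc a b) +
    sSup ((fun x => ‖combCaputoVec a b α β γ y x‖) '' Icc a b)

/-- Partial derivative of `L` with respect to the `i`-th component of its second
(vector) argument, i.e. `∂_{i+2} L` in the paper's numbering (`i : Fin N` ↦ `i+2`). -/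
def pY {N : ℕ} (L : ℝ → (Fin N → ℝ) → (Fin N → ℝ) → (Fin N → ℝ) → ℝ)
    (x : ℝ) (u v w : Fin N → ℝ) (i : Fin N) : ℝ :=
  deriv (fun s => L x (Function.update u i s) v w) (u i)

/-- Partial derivative w.r.t. the `i`-th component of the third argument (`∂_{N+i+2} L`). -/
def pV {N : ℕ} (L : ℝ → (Fin N → ℝ) → (Fin N → ℝ) → (Fin N → ℝ) → ℝ)
    (x : ℝ) (u v w : Fin N → ℝ) (i : Fin N) : ℝ :=
  deriv (fun s => L x u (Function.update v i s) w) (v i)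

/-- Partial derivative w.r.t. the `i`-th component of the fourth argument (`∂_{2N+i+2} L`). -/
def pW {N : ℕ} (L : ℝ → (Fin N → ℝ) → (Fin N → ℝ) → (Fin N → ℝ) → ℝ)
    (x : ℝ) (u v w : Fin N → ℝ) (i : Fin N) : ℝ :=
  deriv (fun s => L x u v (Function.update w i s)) (w i)

/-- `L[y](x) = L(x, y(x), y'(x), ^C D^{α,β}_γ y(x))`. -/
def lagAlong (a b α β γ : ℝ) {N : ℕ} (L : ℝ → (Fin N → ℝ) → (Fin N → ℝ) → (Fin N → ℝ) → ℝ)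
    (y : ℝ → Fin N → ℝ) (x : ℝ) : ℝ :=
  L x (y x) (deriv y x) (combCaputoVec a b α β γ y x)

def pYAlong (a b α β γ : ℝ) {N : ℕ} (L : ℝ → (Fin N → ℝ) → (Fin N → ℝ) → (Fin N → ℝ) → ℝ)
    (y : ℝ → Fin N → ℝ) (i : Fin N) (x : ℝ) : ℝ :=
  pY L x (y x) (deriv y x) (combCaputoVec a b α β γ y x) i

def pVAlong (a b α β γ : ℝ) {N : ℕ} (L : ℝ → (Fin N → ℝ) → (Fin N → ℝ) → (Fin N → ℝ) → ℝ)
    (y : ℝ → Fin N → ℝ) (i : Fin N) (x : ℝ) : ℝ :=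
  pV L x (y x) (deriv y x) (combCaputoVec a b α β γ y x) i

def pWAlong (a b α β γ : ℝ) {N : ℕ} (L : ℝ → (Fin N → ℝ) → (Fin N → ℝ) → (Fin N → ℝ) → ℝ)
    (y : ℝ → Fin N → ℝ) (i : Fin N) (x : ℝ) : ℝ :=
  pW L x (y x) (deriv y x) (combCaputoVec a b α β γ y x) i

/-- `g` is continuously differentiable on `[a,b]`. -/
def ContDiffOn1 (a b : ℝ) (g : ℝ → ℝ) : Prop :=
  (∀ x ∈ Icc a b, DifferentiableAt ℝ g x) ∧ ContinuousOn (deriv g) (Icc a b)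

/-- `g` admits a continuous left Riemann–Liouville derivative `ₐD_x^β` on `[a,b]`. -/
def HasContLeftRLD (a b β : ℝ) (g : ℝ → ℝ) : Prop :=
  (∀ x ∈ Icc a b, DifferentiableAt ℝ (fun s => ∫ t in a..s, (s - t) ^ (-β) * g t) x) ∧
  ContinuousOn (leftRLD a β g) (Icc a b)

/-- `g` admits a continuous right Riemann–Liouville derivative `ₓD_b^α` on `[a,b]`. -/
def HasContRightRLD (a b α : ℝ) (g : ℝ → ℝ) : Prop :=
  (∀ x ∈ Icc a b, DifferentiableAt ℝ (fun s => ∫ t in s..b, (t - s) ^ (-α) * g t) x) ∧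
  ContinuousOn (rightRLD b α g) (Icc a b)

/-- The functional `J(y) = ∫_a^b L[y](x) dx`. -/
def Jfun (a b α β γ : ℝ) {N : ℕ} (L : ℝ → (Fin N → ℝ) → (Fin N → ℝ) → (Fin N → ℝ) → ℝ)
    (y : ℝ → Fin N → ℝ) : ℝ :=
  ∫ x in a..b, lagAlong a b α β γ L y x



lemma fk_int {a x α : ℝ} (hα : α < 1) (hax : a ≤ x) {f : ℝ → ℝ} (hf : ContinuousOn f (Icc a x)) :
    IntervalIntegrable (fun t => (x - t) ^ (-α) * f t) volume a x := by
  have h := (intervalIntegral.intervalIntegrable_rpow' (r := -α) (a := x - a) (b := 0)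
    (by linarith)).comp_sub_left x
  simp only [sub_sub_cancel, sub_zero] at h
  exact h.mul_continuousOn (by rwa [uIcc_of_le hax])

lemma fk_intR {b x α : ℝ} (hα : α < 1) (hax : x ≤ b) {f : ℝ → ℝ} (hf : ContinuousOn f (Icc x b)) :
    IntervalIntegrable (fun t => (t - x) ^ (-α) * f t) volume x b := by
  have h := (intervalIntegral.intervalIntegrable_rpow' (r := -α) (a := 0) (b := b - x)
    (by linarith)).comp_sub_right x
  simp only [zero_add, sub_add_cancel] at h
  exact h.mul_continuousOn (by rwa [uIcc_of_le hax])

lemma fk_cont {a b α : ℝ} (hα : α < 1) (hab : a ≤ b) {f : ℝ → ℝ} (hf : ContinuousOn f (Icc a b)) :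
    ContinuousOn (fun x => ∫ t in a..x, (x - t) ^ (-α) * f t) (Icc a b) := by
  obtain ⟨C, hC⟩ := isCompact_Icc.exists_bound_of_continuousOn hf
  set g : ℝ → ℝ := IccExtend hab ((Icc a b).domRestrict f) with hg
  have gc : Continuous g := (continuousOn_iff_continuous_domRestrict.1 hf).Icc_extend'
  have gb : ∀ x, ‖g x‖ ≤ C := fun x => hC _ (projIcc a b hab x).2
  have ge : ∀ x ∈ Icc a b, g x = f x := fun x hx => by
    rw [hg, IccExtend_of_mem hab _ hx]; rfl
  have key : ∀ x ∈ Icc a b, (∫ t in a..x, (x - t) ^ (-α) * f t)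
      = (x - a) ^ (1 - α) * ∫ s in (0:ℝ)..1, (1 - s) ^ (-α) * g (a + (x - a) * s) := by
    intro x hx
    have h1 : (∫ t in a..x, (x - t) ^ (-α) * f t) = ∫ t in a..x, (x - t) ^ (-α) * g t := by
      apply intervalIntegral.integral_congr
      intro t ht
      rw [uIcc_of_le hx.1] at ht
      simp only
      rw [ge t ⟨ht.1, ht.2.trans hx.2⟩]
    rw [h1]
    rcases hx.1.eq_or_lt with h | h
    · subst h
      simp [Real.zero_rpow (by linarith : (1 - α) ≠ 0)]
    · have h2 := intervalIntegral.smul_integral_comp_add_mul (a := 0) (b := 1)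
        (fun t => (x - t) ^ (-α) * g t) (x - a) a
      simp only [mul_zero, add_zero, mul_one, add_sub_cancel] at h2
      rw [← h2, smul_eq_mul, ← intervalIntegral.integral_const_mul,
        ← intervalIntegral.integral_const_mul]
      apply intervalIntegral.integral_congr
      intro s hs
      rw [uIcc_of_le zero_le_one] at hs
      simp only
      have h3 : x - (a + (x - a) * s) = (x - a) * (1 - s) := by ring
      rw [h3, Real.mul_rpow (by linarith) (by linarith [hs.2]),
        show (1 - α) = 1 + (-α) by ring, Real.rpow_add (by linarith), Real.rpow_one]
      ring
  refine ContinuousOn.congr ?_ key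
  apply Continuous.continuousOn
  apply Continuous.mul
  · exact (continuous_id.sub continuous_const).rpow_const fun x => Or.inr (by linarith)
  · apply intervalIntegral.continuous_of_dominated_interval
      (bound := fun s => (1 - s) ^ (-α) * C)
    · intro x
      apply Measurable.aestronglyMeasurable
      have := gc.measurable
      fun_prop
    · intro x
      refine Filter.Eventually.of_forall fun t ht => ?_
      rw [uIoc_of_le zero_le_one] at ht
      rw [norm_mul, Real.norm_of_nonneg (Real.rpow_nonneg (by linarith [ht.2]) _)]
      exact mul_le_mul_of_nonneg_left (gb _) (Real.rpow_nonneg (by linarith [ht.2]) _)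
    · exact fk_int hα zero_le_one continuousOn_const
    · refine Filter.Eventually.of_forall fun t ht => ?_
      fun_prop

lemma fk_contR {a b α : ℝ} (hα : α < 1) (hab : a ≤ b) {f : ℝ → ℝ} (hf : ContinuousOn f (Icc a b)) :
    ContinuousOn (fun x => ∫ t in x..b, (t - x) ^ (-α) * f t) (Icc a b) := by
  have h := fk_cont (a := -b) (b := -a) (f := fun t => f (-t)) hα (by linarith)
    (hf.comp continuous_neg.continuousOn fun t ht => ⟨by linarith [ht.2], by linarith [ht.1]⟩)
  have h2 := h.comp (s := Icc a b) (f := fun x => -x) continuous_neg.continuousOn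
    fun t ht => ⟨by linarith [ht.2], by linarith [ht.1]⟩
  refine h2.congr fun x hx => ?_
  have := intervalIntegral.integral_comp_neg (a := -b) (b := -x) (fun t => (t - x) ^ (-α) * f t)
  simp only [neg_neg] at this
  simp only [Function.comp]
  rw [← this]
  congr 1; ext t; congr 2; ring

lemma fk_fubini {a b α : ℝ} (hα : α < 1) (hab : a ≤ b) {f g : ℝ → ℝ}
    (hf : ContinuousOn f (Icc a b)) (hg : ContinuousOn g (Icc a b)) :
    (∫ x in a..b, g x * ∫ t in a..x, (x - t) ^ (-α) * f t)
      = ∫ t in a..b, f t * ∫ x in t..b, (x - t) ^ (-α) * g x := by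
  obtain ⟨C, hC⟩ := isCompact_Icc.exists_bound_of_continuousOn hg
  set F := indicator (Ioc a b) f
  set G := indicator (Ioc a b) g
  set h : ℝ → ℝ := indicator (Ioc 0 (b - a)) fun s => s ^ (-α)
  have Fi : Integrable F := by
    rw [integrable_indicator_iff measurableSet_Ioc]
    exact (hf.integrableOn_Icc).mono_set Ioc_subset_Icc_self
  have hi : Integrable h := by
    rw [integrable_indicator_iff measurableSet_Ioc,
      ← intervalIntegrable_iff_integrableOn_Ioc_of_le (by linarith)]
    exact intervalIntegral.intervalIntegrable_rpow' (by linarith)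
  have Gm : AEStronglyMeasurable G volume := by
    rw [aestronglyMeasurable_indicator_iff measurableSet_Ioc]
    exact (hg.mono Ioc_subset_Icc_self).aestronglyMeasurable measurableSet_Ioc
  have C0 : 0 ≤ C := (norm_nonneg _).trans (hC a ⟨le_rfl, hab⟩)
  have I1 := Integrable.convolution_integrand (ContinuousLinearMap.mul ℝ ℝ) Fi hi
  have I2 : Integrable (Function.uncurry fun x t => G x * (F t * h (x - t)))
      ((volume : Measure ℝ).prod volume) := by
    refine I1.bdd_mul (c := C) (f := fun p => G p.1) Gm.comp_fst ?_
    refine Filter.Eventually.of_forall fun p => ?_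
    by_cases hp : p.1 ∈ Ioc a b
    · simp only [G, indicator_of_mem hp]; exact hC _ ⟨hp.1.le, hp.2⟩
    · simp only [G, indicator_of_notMem hp]; simpa using C0
  have sw := integral_integral_swap I2
  have e1 : (∫ x, ∫ t, G x * (F t * h (x - t)))
      = ∫ x in a..b, g x * ∫ t in a..x, (x - t) ^ (-α) * f t := by
    rw [intervalIntegral.integral_of_le hab, ← integral_indicator measurableSet_Ioc]
    congr 1; ext x
    rw [integral_const_mul]
    by_cases hx : x ∈ Ioc a b
    · rw [indicator_of_mem hx]
      simp only [G, indicator_of_mem hx]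
      congr 1
      rw [intervalIntegral.integral_of_le hx.1.le, integral_Ioc_eq_integral_Ioo,
        ← integral_indicator measurableSet_Ioo]
      congr 1; ext t
      simp only [F, h, indicator, mem_Ioc, mem_Ioo] at hx ⊢
      split_ifs <;> first | ring1 | (exfalso; grind)
    · simp only [G, indicator_of_notMem hx, zero_mul]
  have e2 : (∫ t, ∫ x, G x * (F t * h (x - t)))
      = ∫ t in a..b, f t * ∫ x in t..b, (x - t) ^ (-α) * g x := by
    rw [intervalIntegral.integral_of_le hab, ← integral_indicator measurableSet_Ioc]
    congr 1; ext t
    have : ∀ x, G x * (F t * h (x - t)) = F t * (G x * h (x - t)) := fun x => by ring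
    simp_rw [this]
    rw [integral_const_mul]
    by_cases ht : t ∈ Ioc a b
    · rw [indicator_of_mem ht]
      simp only [F, indicator_of_mem ht]
      congr 1
      rw [intervalIntegral.integral_of_le ht.2,
        ← integral_indicator measurableSet_Ioc]
      congr 1; ext x
      simp only [G, h, indicator, mem_Ioc] at ht ⊢
      split_ifs <;> first | ring1 | (exfalso; grind)
    · simp only [F, indicator_of_notMem ht, zero_mul]
  rw [← e1, sw, e2]

lemma var_abs {E : Type*} [NormedAddCommGroup E] [NormedSpace ℝ E] {Φ : E → ℝ}
    (hΦ : ContDiff ℝ 1 Φ) {a b : ℝ} (hab : a ≤ b) {p q : ℝ → E}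
    (hp : ContinuousOn p (Icc a b)) (hq : ContinuousOn q (Icc a b)) :
    HasDerivAt (fun ε : ℝ => ∫ x in a..b, Φ (p x + ε • q x))
      (∫ x in a..b, fderiv ℝ Φ (p x) (q x)) 0 := by
  have hfd : Continuous (fderiv ℝ Φ) := hΦ.continuous_fderiv one_ne_zero
  have hc : ContinuousOn (fun z : ℝ × ℝ => fderiv ℝ Φ (p z.2 + z.1 • q z.2) (q z.2))
      (Icc (-1) 1 ×ˢ Icc a b) := by
    have hp2 : ContinuousOn (fun z : ℝ × ℝ => p z.2) (Icc (-1) 1 ×ˢ Icc a b) :=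
      hp.comp continuousOn_snd fun z hz => hz.2
    have hq2 : ContinuousOn (fun z : ℝ × ℝ => q z.2) (Icc (-1) 1 ×ˢ Icc a b) :=
      hq.comp continuousOn_snd fun z hz => hz.2
    exact (hfd.comp_continuousOn (hp2.add (continuousOn_fst.smul hq2))).clm_apply hq2
  obtain ⟨C, hC⟩ := (isCompact_Icc.prod isCompact_Icc).exists_bound_of_continuousOn hc
  have hpc : ∀ ε : ℝ, ContinuousOn (fun x => Φ (p x + ε • q x)) (Icc a b) := fun ε =>
    hΦ.continuous.comp_continuousOn (hp.add (hq.const_smul ε))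
  have hsub : uIoc a b ⊆ Icc a b := by rw [uIoc_of_le hab]; exact Ioc_subset_Icc_self
  have hms : ∀ f : ℝ → ℝ, ContinuousOn f (Icc a b) →
      AEStronglyMeasurable f (volume.restrict (uIoc a b)) := fun f hf =>
    (hf.mono hsub).aestronglyMeasurable measurableSet_uIoc
  have := (intervalIntegral.hasDerivAt_integral_of_dominated_loc_of_deriv_le (μ := volume)
    (a := a) (b := b) (F := fun (ε : ℝ) x => Φ (p x + ε • q x))
    (F' := fun (ε : ℝ) x => fderiv ℝ Φ (p x + ε • q x) (q x)) (x₀ := (0:ℝ)) (s := Icc (-1) 1)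
    (bound := fun _ => C) (Icc_mem_nhds (by norm_num) (by norm_num))
    (Filter.Eventually.of_forall fun ε => hms _ (hpc ε))
    ((hpc 0).intervalIntegrable_of_Icc hab)
    (hms _ ((hfd.comp_continuousOn (hp.add (hq.const_smul 0))).clm_apply hq))
    (Filter.Eventually.of_forall fun t ht ε hε => hC (ε, t) ⟨hε, hsub ht⟩)
    intervalIntegrable_const
    (Filter.Eventually.of_forall fun t ht ε hε => by
      have h1 : HasDerivAt (fun ε : ℝ => p t + ε • q t) (q t) ε := by
        simpa using ((hasDerivAt_id ε).smul_const (q t)).const_add (p t)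
      exact ((hΦ.differentiable one_ne_zero _).hasFDerivAt).comp_hasDerivAt ε h1)).2
  simpa using this

lemma caputoL_cont {a b α : ℝ} (hα : α < 1) (hab : a ≤ b) {η : ℝ → ℝ}
    (hη : ContinuousOn (deriv η) (Icc a b)) : ContinuousOn (caputoL a α η) (Icc a b) :=
  continuousOn_const.mul (fk_cont hα hab hη)

lemma caputoR_cont {a b α : ℝ} (hα : α < 1) (hab : a ≤ b) {η : ℝ → ℝ}
    (hη : ContinuousOn (deriv η) (Icc a b)) : ContinuousOn (caputoR b α η) (Icc a b) :=
  continuousOn_const.mul (fk_contR hα hab hη)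

lemma combCaputo_cont {a b α β : ℝ} (γ : ℝ) (hα : α < 1) (hβ : β < 1) (hab : a ≤ b) {η : ℝ → ℝ}
    (hη : ContinuousOn (deriv η) (Icc a b)) : ContinuousOn (combCaputo a b α β γ η) (Icc a b) :=
  (continuousOn_const.mul (caputoL_cont hα hab hη)).add
    (continuousOn_const.mul (caputoR_cont hβ hab hη))

lemma combCaputo_smul (a b α β γ c : ℝ) (η : ℝ → ℝ) (x : ℝ) :
    combCaputo a b α β γ (fun t => c * η t) x = c * combCaputo a b α β γ η x := by
  have h1 : ∀ t s : ℝ, s * (c * deriv η t) = c * (s * deriv η t) := fun t s => by ring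
  simp only [combCaputo, caputoL, caputoR, deriv_const_mul_field, h1,
    intervalIntegral.integral_const_mul]
  ring

lemma combCaputo_add {a b α β γ : ℝ} (hα : α < 1) (hβ : β < 1) {u v : ℝ → ℝ}
    (hu : ∀ x ∈ Icc a b, DifferentiableAt ℝ u x) (hu' : ContinuousOn (deriv u) (Icc a b))
    (hv : ∀ x ∈ Icc a b, DifferentiableAt ℝ v x) (hv' : ContinuousOn (deriv v) (Icc a b))
    {x : ℝ} (hx : x ∈ Icc a b) :
    combCaputo a b α β γ (fun t => u t + v t) x
      = combCaputo a b α β γ u x + combCaputo a b α β γ v x := by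
  have hd : ∀ t ∈ Icc a b, deriv (fun t => u t + v t) t = deriv u t + deriv v t :=
    fun t ht => deriv_fun_add (hu t ht) (hv t ht)
  have s1 : Icc a x ⊆ Icc a b := Icc_subset_Icc_right hx.2
  have s2 : Icc x b ⊆ Icc a b := Icc_subset_Icc_left hx.1
  have e1 : (∫ t in a..x, (x - t) ^ (-α) * deriv (fun t => u t + v t) t)
      = (∫ t in a..x, (x - t) ^ (-α) * deriv u t) + ∫ t in a..x, (x - t) ^ (-α) * deriv v t := by
    rw [← intervalIntegral.integral_add (fk_int hα hx.1 (hu'.mono s1))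
      (fk_int hα hx.1 (hv'.mono s1))]
    apply intervalIntegral.integral_congr
    intro t ht
    rw [uIcc_of_le hx.1] at ht
    simp only [hd t (s1 ht), mul_add]
  have e2 : (∫ t in x..b, (t - x) ^ (-β) * deriv (fun t => u t + v t) t)
      = (∫ t in x..b, (t - x) ^ (-β) * deriv u t) + ∫ t in x..b, (t - x) ^ (-β) * deriv v t := by
    rw [← intervalIntegral.integral_add (fk_intR hβ hx.2 (hu'.mono s2))
      (fk_intR hβ hx.2 (hv'.mono s2))]
    apply intervalIntegral.integral_congr
    intro t ht
    rw [uIcc_of_le hx.2] at ht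
    simp only [hd t (s2 ht), mul_add]
  simp only [combCaputo, caputoL, caputoR, e1, e2]
  ring

/-- The perturbation in direction `i`. -/
def pert {N : ℕ} (i : Fin N) (η : ℝ → ℝ) (x : ℝ) : Fin N → ℝ := η x • Pi.single i (1:ℝ)

lemma pert_hasDeriv {N : ℕ} (i : Fin N) {η : ℝ → ℝ} (hη : ContDiff ℝ 1 η) (x : ℝ) :
    HasDerivAt (pert i η) (pert i (deriv η) x) x :=
  ((hη.differentiable one_ne_zero x).hasDerivAt).smul_const _

lemma pert_cont {N : ℕ} (i : Fin N) {η : ℝ → ℝ} {s : Set ℝ} (hη : ContinuousOn η s) :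
    ContinuousOn (pert i η) s :=
  hη.smul continuousOn_const

lemma combCaputoVec_pert (a b α β γ : ℝ) {N : ℕ} (i : Fin N) (η : ℝ → ℝ) (ε x : ℝ) :
    combCaputoVec a b α β γ (fun t => ε • pert i η t) x
      = ε • pert i (combCaputo a b α β γ η) x := by
  funext j
  have : (fun t => (ε • pert i η t) j) = fun t => (ε * (Pi.single i (1:ℝ) : Fin N → ℝ) j) * η t := by
    funext t; simp only [pert, Pi.smul_apply, smul_eq_mul]; ring
  simp only [combCaputoVec, this, combCaputo_smul]
  simp only [pert, Pi.smul_apply, smul_eq_mul]; ring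

lemma MemD.comp_diff {a b α β γ : ℝ} {N : ℕ} {y : ℝ → Fin N → ℝ} (hy : MemD a b α β γ y)
    (j : Fin N) : (∀ x ∈ Icc a b, DifferentiableAt ℝ (fun t => y t j) x) ∧
      ContinuousOn (deriv fun t => y t j) (Icc a b) := by
  have h : ∀ x ∈ Icc a b, HasDerivAt (fun t => y t j) (deriv y x j) x := fun x hx =>
    (hasDerivAt_pi.1 (hy.1 x hx).hasDerivAt) j
  refine ⟨fun x hx => (h x hx).differentiableAt, ?_⟩
  exact ((continuous_apply j).comp_continuousOn hy.2.1).congr fun x hx => (h x hx).deriv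

lemma combCaputoVec_var {a b α β γ : ℝ} (hα : α < 1) (hβ : β < 1) {N : ℕ} {y : ℝ → Fin N → ℝ}
    (hy : MemD a b α β γ y) (i : Fin N) {η : ℝ → ℝ} (hη : ContDiff ℝ 1 η) (ε : ℝ)
    {x : ℝ} (hx : x ∈ Icc a b) :
    combCaputoVec a b α β γ (fun t => y t + ε • pert i η t) x
      = combCaputoVec a b α β γ y x + ε • pert i (combCaputo a b α β γ η) x := by
  rw [← combCaputoVec_pert]
  funext j
  have hd : ∀ x, HasDerivAt (fun t => (ε • pert i η t) j)
      ((ε * deriv η x) * (Pi.single i (1:ℝ) : Fin N → ℝ) j) x := fun x => by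
    have := (hasDerivAt_pi.1 ((pert_hasDeriv i hη x).const_smul ε)) j
    refine this.congr_deriv ?_
    simp only [pert, Pi.smul_apply, smul_eq_mul]; ring
  simp only [combCaputoVec, Pi.add_apply]
  refine combCaputo_add hα hβ (hy.comp_diff j).1 (hy.comp_diff j).2
    (fun x _ => (hd x).differentiableAt) ?_ hx
  have : deriv (fun t => (ε • pert i η t) j)
      = fun x => ((ε * deriv η x) * (Pi.single i (1:ℝ) : Fin N → ℝ) j) := funext fun x => (hd x).deriv
  rw [this]
  have := hη.continuous_deriv le_rfl
  fun_prop

lemma deriv_var {a b α β γ : ℝ} {N : ℕ} {y : ℝ → Fin N → ℝ}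
    (hy : MemD a b α β γ y) (i : Fin N) {η : ℝ → ℝ} (hη : ContDiff ℝ 1 η) (ε : ℝ)
    {x : ℝ} (hx : x ∈ Icc a b) :
    HasDerivAt (fun t => y t + ε • pert i η t) (deriv y x + ε • pert i (deriv η) x) x :=
  (hy.1 x hx).hasDerivAt.add ((pert_hasDeriv i hη x).const_smul ε)

lemma MemD_var {a b α β γ : ℝ} (hab : a ≤ b) (hα : α < 1) (hβ : β < 1) {N : ℕ}
    {y : ℝ → Fin N → ℝ}
    (hy : MemD a b α β γ y) (i : Fin N) {η : ℝ → ℝ} (hη : ContDiff ℝ 1 η) (ε : ℝ) :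
    MemD a b α β γ (fun t => y t + ε • pert i η t) := by
  have hc := (hη.continuous_deriv le_rfl).continuousOn (s := Icc a b)
  refine ⟨fun x hx => (deriv_var hy i hη ε hx).differentiableAt, ?_, ?_⟩
  · exact (hy.2.1.add ((pert_cont i hc).const_smul ε)).congr
      fun x hx => (deriv_var hy i hη ε hx).deriv
  · exact (hy.2.2.add ((pert_cont i (combCaputo_cont γ hα hβ hab hc)).const_smul ε)).congr
      fun x hx => combCaputoVec_var hα hβ hy i hη ε hx

lemma norm_pert {N : ℕ} (i : Fin N) (η : ℝ → ℝ) (x : ℝ) : ‖pert i η x‖ = ‖η x‖ := by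
  simp [pert, norm_smul, Pi.norm_single]

lemma norm1inf_small {a b α β γ : ℝ} (hab : a ≤ b) (hα : α < 1) (hβ : β < 1) {N : ℕ}
    (i : Fin N) {η : ℝ → ℝ} (hη : ContDiff ℝ 1 η) {δ : ℝ} (hδ : 0 < δ) :
    ∀ᶠ ε in nhds (0:ℝ), norm1inf a b α β γ (fun t => ε • pert i η t) < δ := by
  have hc := (hη.continuous_deriv le_rfl).continuousOn (s := Icc a b)
  obtain ⟨C1, h1⟩ := isCompact_Icc.exists_bound_of_continuousOn (hη.continuous.continuousOn (s := Icc a b))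
  obtain ⟨C2, h2⟩ := isCompact_Icc.exists_bound_of_continuousOn hc
  obtain ⟨C3, h3⟩ := isCompact_Icc.exists_bound_of_continuousOn (combCaputo_cont γ hα hβ hab hc)
  have hle : ∀ ε, norm1inf a b α β γ (fun t => ε • pert i η t) ≤ |ε| * C1 + |ε| * C2 + |ε| * C3 := by
    intro ε
    have hne : (Icc a b).Nonempty := nonempty_Icc.2 hab
    refine add_le_add (add_le_add ?_ ?_) ?_
    · refine csSup_le (hne.image _) ?_
      rintro _ ⟨x, hx, rfl⟩
      simp only [norm_smul, norm_pert, Real.norm_eq_abs ε]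
      exact mul_le_mul_of_nonneg_left (h1 x hx) (abs_nonneg _)
    · refine csSup_le (hne.image _) ?_
      rintro _ ⟨x, hx, rfl⟩
      have : deriv (fun t => ε • pert i η t) x = ε • pert i (deriv η) x :=
        ((pert_hasDeriv i hη x).const_smul ε).deriv
      simp only [this, norm_smul, norm_pert, Real.norm_eq_abs ε]
      exact mul_le_mul_of_nonneg_left (h2 x hx) (abs_nonneg _)
    · refine csSup_le (hne.image _) ?_
      rintro _ ⟨x, hx, rfl⟩
      simp only [combCaputoVec_pert, norm_smul, norm_pert, Real.norm_eq_abs ε]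
      exact mul_le_mul_of_nonneg_left (h3 x hx) (abs_nonneg _)
  have ht : Continuous fun ε : ℝ => |ε| * C1 + |ε| * C2 + |ε| * C3 := by fun_prop
  have := ht.tendsto 0
  simp only [abs_zero, zero_mul, add_zero] at this
  filter_upwards [this.eventually_lt_const hδ] with ε hε
  exact (hle ε).trans_lt hε

section
variable {N : ℕ} {L : ℝ → (Fin N → ℝ) → (Fin N → ℝ) → (Fin N → ℝ) → ℝ}

lemma pY_eq (hL : ContDiff ℝ 1 fun p : ℝ × (Fin N → ℝ) × (Fin N → ℝ) × (Fin N → ℝ) =>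
      L p.1 p.2.1 p.2.2.1 p.2.2.2) (x : ℝ) (u v w : Fin N → ℝ) (i : Fin N) :
    pY L x u v w i = fderiv ℝ (fun p : ℝ × (Fin N → ℝ) × (Fin N → ℝ) × (Fin N → ℝ) =>
      L p.1 p.2.1 p.2.2.1 p.2.2.2) (x, u, v, w) (0, Pi.single i 1, 0, 0) := by
  have h := (hL.differentiable one_ne_zero (x, u, v, w)).hasFDerivAt
  have h1 : HasDerivAt (fun s => (x, Function.update u i s, v, w)) (0, Pi.single i 1, 0, 0) (u i) :=
    (hasDerivAt_const _ _).prodMk ((hasDerivAt_update u i (u i)).prodMk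
      ((hasDerivAt_const _ _).prodMk (hasDerivAt_const _ _)))
  exact (HasFDerivAt.comp_hasDerivAt (u i) (by simpa using h) h1).deriv

lemma pV_eq (hL : ContDiff ℝ 1 fun p : ℝ × (Fin N → ℝ) × (Fin N → ℝ) × (Fin N → ℝ) =>
      L p.1 p.2.1 p.2.2.1 p.2.2.2) (x : ℝ) (u v w : Fin N → ℝ) (i : Fin N) :
    pV L x u v w i = fderiv ℝ (fun p : ℝ × (Fin N → ℝ) × (Fin N → ℝ) × (Fin N → ℝ) =>
      L p.1 p.2.1 p.2.2.1 p.2.2.2) (x, u, v, w) (0, 0, Pi.single i 1, 0) := by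
  have h := (hL.differentiable one_ne_zero (x, u, v, w)).hasFDerivAt
  have h1 : HasDerivAt (fun s => (x, u, Function.update v i s, w)) (0, 0, Pi.single i 1, 0) (v i) :=
    (hasDerivAt_const _ _).prodMk ((hasDerivAt_const _ _).prodMk
      ((hasDerivAt_update v i (v i)).prodMk (hasDerivAt_const _ _)))
  exact (HasFDerivAt.comp_hasDerivAt (v i) (by simpa using h) h1).deriv

lemma pW_eq (hL : ContDiff ℝ 1 fun p : ℝ × (Fin N → ℝ) × (Fin N → ℝ) × (Fin N → ℝ) =>
      L p.1 p.2.1 p.2.2.1 p.2.2.2) (x : ℝ) (u v w : Fin N → ℝ) (i : Fin N) :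
    pW L x u v w i = fderiv ℝ (fun p : ℝ × (Fin N → ℝ) × (Fin N → ℝ) × (Fin N → ℝ) =>
      L p.1 p.2.1 p.2.2.1 p.2.2.2) (x, u, v, w) (0, 0, 0, Pi.single i 1) := by
  have h := (hL.differentiable one_ne_zero (x, u, v, w)).hasFDerivAt
  have h1 : HasDerivAt (fun s => (x, u, v, Function.update w i s)) (0, 0, 0, Pi.single i 1) (w i) :=
    (hasDerivAt_const _ _).prodMk ((hasDerivAt_const _ _).prodMk
      ((hasDerivAt_const _ _).prodMk (hasDerivAt_update w i (w i))))
  exact (HasFDerivAt.comp_hasDerivAt (w i) (by simpa using h) h1).deriv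

lemma along_cont {a b α β γ : ℝ} {y : ℝ → Fin N → ℝ} (hy : MemD a b α β γ y) :
    ContinuousOn (fun x => (x, y x, deriv y x, combCaputoVec a b α β γ y x)) (Icc a b) :=
  continuousOn_id.prodMk ((show ContinuousOn y (Icc a b) from
    fun x hx => (hy.1 x hx).continuousAt.continuousWithinAt).prodMk (hy.2.1.prodMk hy.2.2))

lemma first_var {a b α β γ : ℝ} (hab : a ≤ b) (hα : α < 1) (hβ : β < 1)
    (hL : ContDiff ℝ 1 fun p : ℝ × (Fin N → ℝ) × (Fin N → ℝ) × (Fin N → ℝ) =>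
      L p.1 p.2.1 p.2.2.1 p.2.2.2) {y : ℝ → Fin N → ℝ} (hy : MemD a b α β γ y) (i : Fin N)
    {η : ℝ → ℝ} (hη : ContDiff ℝ 1 η) :
    HasDerivAt (fun ε : ℝ => Jfun a b α β γ L (fun t => y t + ε • pert i η t))
      (∫ x in a..b, (pYAlong a b α β γ L y i x * η x + pVAlong a b α β γ L y i x * deriv η x
        + pWAlong a b α β γ L y i x * combCaputo a b α β γ η x)) 0 := by
  have hc := (hη.continuous_deriv le_rfl).continuousOn (s := Icc a b)
  have h := var_abs hL hab (along_cont hy)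
    (q := fun x => (0, pert i η x, pert i (deriv η) x, pert i (combCaputo a b α β γ η) x))
    (continuousOn_const.prodMk ((pert_cont i hη.continuous.continuousOn).prodMk
      ((pert_cont i hc).prodMk (pert_cont i (combCaputo_cont γ hα hβ hab hc)))))
  convert h using 1
  · funext ε
    apply intervalIntegral.integral_congr
    intro x hx
    rw [uIcc_of_le hab] at hx
    simp only [lagAlong, (deriv_var hy i hη ε hx).deriv, combCaputoVec_var hα hβ hy i hη ε hx]
    simp
  · apply intervalIntegral.integral_congr
    intro x hx
    simp only [pYAlong, pVAlong, pWAlong, pY_eq hL, pV_eq hL, pW_eq hL]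
    have : ((0:ℝ), pert i η x, pert i (deriv η) x, pert i (combCaputo a b α β γ η) x)
      = η x • ((0:ℝ), (Pi.single i 1 : Fin N → ℝ), (0 : Fin N → ℝ), (0 : Fin N → ℝ))
        + deriv η x • ((0:ℝ), (0 : Fin N → ℝ), (Pi.single i 1 : Fin N → ℝ), (0 : Fin N → ℝ))
        + combCaputo a b α β γ η x •
          ((0:ℝ), (0 : Fin N → ℝ), (0 : Fin N → ℝ), (Pi.single i 1 : Fin N → ℝ)) := by
      simp [pert]
    rw [this, map_add, map_add, map_smul, map_smul, map_smul]
    simp only [smul_eq_mul]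
    ring

end

lemma int_comb {a b : ℝ} (hab : a ≤ b) {f1 f2 f3 f4 : ℝ → ℝ} (s c d : ℝ)
    (h1 : ContinuousOn f1 (Icc a b)) (h2 : ContinuousOn f2 (Icc a b))
    (h3 : ContinuousOn f3 (Icc a b)) (h4 : ContinuousOn f4 (Icc a b)) :
    (∫ x in a..b, ((f1 x + s * f2 x) + (c * f3 x + d * f4 x)))
      = (∫ x in a..b, f1 x) + s * (∫ x in a..b, f2 x)
        + (c * (∫ x in a..b, f3 x) + d * ∫ x in a..b, f4 x) := by
  have i1 := h1.intervalIntegrable_of_Icc (μ := volume) hab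
  have i2 := (h2.intervalIntegrable_of_Icc (μ := volume) hab).const_mul s
  have i3 := (h3.intervalIntegrable_of_Icc (μ := volume) hab).const_mul c
  have i4 := (h4.intervalIntegrable_of_Icc (μ := volume) hab).const_mul d
  rw [intervalIntegral.integral_add (i1.add i2) (i3.add i4), intervalIntegral.integral_add i1 i2,
    intervalIntegral.integral_add i3 i4]
  simp only [intervalIntegral.integral_const_mul]

lemma frac_ibp {a b α β γ : ℝ} (hab : a ≤ b) (hα : α < 1) (hβ : β < 1) {A V g η : ℝ → ℝ}
    (hA : ContinuousOn A (Icc a b)) (hV : ContDiffOn1 a b V) (hg : ContinuousOn g (Icc a b))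
    (hl : HasContLeftRLD a b β g) (hr : HasContRightRLD a b α g) (hη : ContDiff ℝ 1 η)
    (ha : η a = 0) :
    (∫ x in a..b, (A x * η x + V x * deriv η x + g x * combCaputo a b α β γ η x))
      = (∫ x in a..b, (A x - deriv V x + combRLD a b β α γ g x) * η x)
        + η b * (V b + γ * rightRLI b (1 - α) g b - (1 - γ) * leftRLI a (1 - β) g b) := by
  have hc := (hη.continuous_deriv le_rfl).continuousOn (s := Icc a b)
  have hηc := hη.continuous.continuousOn (s := Icc a b)
  have hi : ∀ f : ℝ → ℝ, ContinuousOn f (Icc a b) → IntervalIntegrable f volume a b :=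
    fun f hf => hf.intervalIntegrable_of_Icc hab
  have hVc : ContinuousOn V (Icc a b) := fun x hx => (hV.1 x hx).continuousAt.continuousWithinAt
  have hdη : ∀ x ∈ uIcc a b, HasDerivAt η (deriv η x) x :=
    fun x _ => (hη.differentiable one_ne_zero x).hasDerivAt
  have Ga : Real.Gamma (1 - α) ≠ 0 := (Real.Gamma_pos_of_pos (by linarith)).ne'
  have Gb : Real.Gamma (1 - β) ≠ 0 := (Real.Gamma_pos_of_pos (by linarith)).ne'
  have cL := caputoL_cont hα hab hc
  have cR := caputoR_cont hβ hab hc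
  -- classical part
  have i1 : (∫ x in a..b, V x * deriv η x) = V b * η b - ∫ x in a..b, deriv V x * η x := by
    rw [intervalIntegral.integral_mul_deriv_eq_deriv_mul
      (fun x hx => (hV.1 x (by rwa [uIcc_of_le hab] at hx)).hasDerivAt) hdη (hi _ hV.2) (hi _ hc), ha]
    ring
  -- left Caputo part
  set G : ℝ → ℝ := fun s => ∫ t in s..b, (t - s) ^ (-α) * g t with hG
  have hG' : ContinuousOn (deriv G) (Icc a b) := by
    refine ((continuousOn_const (c := -Real.Gamma (1 - α))).mul hr.2).congr fun x hx => ?_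
    change deriv G x = -Real.Gamma (1 - α) * ((-1 / Real.Gamma (1 - α)) * deriv G x)
    field_simp
  have Gb0 : G b = 0 := by simp [hG]
  have i2 : (∫ x in a..b, g x * caputoL a α η x) = ∫ x in a..b, rightRLD b α g x * η x := by
    have e1 : ∀ x, g x * caputoL a α η x
      = (1 / Real.Gamma (1 - α)) * (g x * ∫ t in a..x, (x - t) ^ (-α) * deriv η t) := fun x => by
        simp only [caputoL]; ring
    have e2 : ∀ x, rightRLD b α g x * η x = (-1 / Real.Gamma (1 - α)) * (deriv G x * η x) :=
      fun x => by simp only [rightRLD, ← hG]; ring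
    simp only [e1, e2, intervalIntegral.integral_const_mul]
    rw [fk_fubini hα hab hc hg]
    have e3 : (∫ t in a..b, deriv η t * ∫ x in t..b, (x - t) ^ (-α) * g x)
        = ∫ t in a..b, G t * deriv η t := by
      congr 1; funext t; rw [mul_comm]
    rw [e3, intervalIntegral.integral_mul_deriv_eq_deriv_mul
      (fun x hx => (hr.1 x (by rwa [uIcc_of_le hab] at hx)).hasDerivAt) hdη (hi _ hG') (hi _ hc),
      ha]
    change 1 / Real.Gamma (1 - α) * (G b * η b - G a * 0 - ∫ x in a..b, deriv G x * η x) = _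
    rw [Gb0]; ring
  set F : ℝ → ℝ := fun s => ∫ t in a..s, (s - t) ^ (-β) * g t with hF
  have hF' : ContinuousOn (deriv F) (Icc a b) := by
    refine ((continuousOn_const (c := Real.Gamma (1 - β))).mul hl.2).congr fun x hx => ?_
    change deriv F x = Real.Gamma (1 - β) * ((1 / Real.Gamma (1 - β)) * deriv F x)
    field_simp
  have i3 : (∫ x in a..b, g x * caputoR b β η x)
      = -(1 / Real.Gamma (1 - β)) * (F b * η b) + ∫ x in a..b, leftRLD a β g x * η x := by
    have e1 : ∀ x, g x * caputoR b β η x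
      = (-1 / Real.Gamma (1 - β)) * (g x * ∫ t in x..b, (t - x) ^ (-β) * deriv η t) := fun x => by
        simp only [caputoR]; ring
    have e2 : ∀ x, leftRLD a β g x * η x = (1 / Real.Gamma (1 - β)) * (deriv F x * η x) :=
      fun x => by simp only [leftRLD, ← hF]; ring
    simp only [e1, e2, intervalIntegral.integral_const_mul]
    rw [← fk_fubini hβ hab hg hc]
    have e3 : (∫ x in a..b, deriv η x * ∫ t in a..x, (x - t) ^ (-β) * g t)
        = ∫ t in a..b, F t * deriv η t := by
      congr 1; funext t; rw [mul_comm]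
    rw [e3, intervalIntegral.integral_mul_deriv_eq_deriv_mul
      (fun x hx => (hl.1 x (by rwa [uIcc_of_le hab] at hx)).hasDerivAt) hdη (hi _ hF') (hi _ hc),
      ha]
    change -1 / Real.Gamma (1 - β) * (F b * η b - F a * 0 - ∫ x in a..b, deriv F x * η x) = _
    ring
  have j1 : rightRLI b (1 - α) g b = 0 := by simp [rightRLI]
  have j2 : leftRLI a (1 - β) g b = (1 / Real.Gamma (1 - β)) * F b := by
    simp only [leftRLI, hF]; congr 2; funext t; congr 2; ring
  have l1 : (∫ x in a..b, (A x * η x + V x * deriv η x + g x * combCaputo a b α β γ η x))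
      = (∫ x in a..b, A x * η x) + (∫ x in a..b, V x * deriv η x)
        + (γ * (∫ x in a..b, g x * caputoL a α η x)
          + (1 - γ) * ∫ x in a..b, g x * caputoR b β η x) := by
    have h := int_comb hab (f1 := fun x => A x * η x) (f2 := fun x => V x * deriv η x)
      (f3 := fun x => g x * caputoL a α η x) (f4 := fun x => g x * caputoR b β η x)
      1 γ (1 - γ) (hA.mul hηc) (hVc.mul hc) (hg.mul cL) (hg.mul cR)
    rw [one_mul] at h
    rw [← h]
    congr 1; funext x; simp only [combCaputo]; ring
  have l2 : (∫ x in a..b, (A x - deriv V x + combRLD a b β α γ g x) * η x)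
      = (∫ x in a..b, A x * η x) - (∫ x in a..b, deriv V x * η x)
        + ((1 - γ) * (∫ x in a..b, leftRLD a β g x * η x)
          + γ * ∫ x in a..b, rightRLD b α g x * η x) := by
    have h := int_comb hab (f1 := fun x => A x * η x) (f2 := fun x => deriv V x * η x)
      (f3 := fun x => leftRLD a β g x * η x) (f4 := fun x => rightRLD b α g x * η x)
      (-1) (1 - γ) γ (hA.mul hηc) (hV.2.mul hηc) (hl.2.mul hηc) (hr.2.mul hηc)
    rw [neg_one_mul, ← sub_eq_add_neg] at h
    rw [← h]
    congr 1; funext x; simp only [combRLD]; ring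
  rw [l1, l2, i1, i2, i3, j1, j2]
  ring

lemma deriv_nonpos_of_left {φ : ℝ → ℝ} {T : ℝ} (h : HasDerivAt φ T 0)
    (hm : ∀ᶠ ε in nhds (0:ℝ), ε ≤ 0 → φ 0 ≤ φ ε) : T ≤ 0 := by
  have h1 := (hasDerivWithinAt_iff_tendsto_slope' (s := Iio (0:ℝ)) (by simp)).1
    (h.hasDerivWithinAt (s := Iio 0))
  refine le_of_tendsto h1 ?_
  filter_upwards [nhdsWithin_le_nhds hm, self_mem_nhdsWithin] with ε h2 h3
  rw [slope_def_field]
  exact div_nonpos_of_nonneg_of_nonpos (by linarith [h2 (le_of_lt h3)])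
    (by simpa using (le_of_lt h3))

/-- Euler–Lagrange equations plus transversality condition when the terminal value of
the `l`-th component is constrained by `y_l(b) ≤ y_l^b`: at `x = b`,
`∂_{N+l+1}L[y] + γ ₓI_b^{1−α}∂_{2N+l+1}L[y] − (1−γ) ₐI_x^{1−β}∂_{2N+l+1}L[y] ≤ 0`,
with equality whenever `y_l(b) < y_l^b`. -/
theorem transversality_inequality_endpoint
    (a b α β γ : ℝ) (N : ℕ) (hab : a < b)
    (hα : α ∈ Ioo (0:ℝ) 1) (hβ : β ∈ Ioo (0:ℝ) 1) (hγ : γ ∈ Icc (0:ℝ) 1)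
    (L : ℝ → (Fin N → ℝ) → (Fin N → ℝ) → (Fin N → ℝ) → ℝ)
    (hL : ContDiff ℝ 1 fun p : ℝ × (Fin N → ℝ) × (Fin N → ℝ) × (Fin N → ℝ) =>
      L p.1 p.2.1 p.2.2.1 p.2.2.2)
    (l : Fin N) (ya : Fin N → ℝ) (yb : Fin N → ℝ) (ylb : ℝ) (y : ℝ → Fin N → ℝ)
    (hy : MemD a b α β γ y) (hya : y a = ya) (hyb : ∀ i : Fin N, i ≠ l → y b i = yb i)
    (hylb : y b l ≤ ylb)
    (hmin : ∃ δ > (0:ℝ), ∀ z : ℝ → Fin N → ℝ, MemD a b α β γ z →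
      z a = ya → (∀ i : Fin N, i ≠ l → z b i = yb i) → z b l ≤ ylb →
      norm1inf a b α β γ (z - y) < δ → Jfun a b α β γ L y ≤ Jfun a b α β γ L z)
    (hC1 : ∀ i : Fin N, ContDiffOn1 a b (pVAlong a b α β γ L y i))
    (hRL : ∀ i : Fin N, HasContLeftRLD a b β (pWAlong a b α β γ L y i) ∧
      HasContRightRLD a b α (pWAlong a b α β γ L y i)) :
    (∀ i : Fin N, ∀ x ∈ Icc a b,
      pYAlong a b α β γ L y i x - deriv (pVAlong a b α β γ L y i) x
        + combRLD a b β α γ (pWAlong a b α β γ L y i) x = 0) ∧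
    (pVAlong a b α β γ L y l b + γ * rightRLI b (1 - α) (pWAlong a b α β γ L y l) b
      - (1 - γ) * leftRLI a (1 - β) (pWAlong a b α β γ L y l) b ≤ 0) ∧
    (y b l < ylb →
      pVAlong a b α β γ L y l b + γ * rightRLI b (1 - α) (pWAlong a b α β γ L y l) b
        - (1 - γ) * leftRLI a (1 - β) (pWAlong a b α β γ L y l) b = 0) := by
  obtain ⟨δ, hδ, hmin⟩ := hmin
  have habl := hab.le
  have hα1 := hα.2
  have hβ1 := hβ.2
  have hfd := hL.continuous_fderiv one_ne_zero
  have cA : ∀ i, ContinuousOn (pYAlong a b α β γ L y i) (Icc a b) := fun i =>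
    ((hfd.comp_continuousOn (along_cont hy)).clm_apply continuousOn_const).congr
      fun x _ => pY_eq hL _ _ _ _ i
  have cW : ∀ i, ContinuousOn (pWAlong a b α β γ L y i) (Icc a b) := fun i =>
    ((hfd.comp_continuousOn (along_cont hy)).clm_apply continuousOn_const).congr
      fun x _ => pW_eq hL _ _ _ _ i
  set E : Fin N → ℝ → ℝ := fun i x => pYAlong a b α β γ L y i x
    - deriv (pVAlong a b α β γ L y i) x + combRLD a b β α γ (pWAlong a b α β γ L y i) x with hE
  have cE : ∀ i, ContinuousOn (E i) (Icc a b) := fun i =>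
    ((cA i).sub (hC1 i).2).add ((continuousOn_const.mul (hRL i).1.2).add
      (continuousOn_const.mul (hRL i).2.2))
  set T : Fin N → ℝ := fun i => pVAlong a b α β γ L y i b
    + γ * rightRLI b (1 - α) (pWAlong a b α β γ L y i) b
    - (1 - γ) * leftRLI a (1 - β) (pWAlong a b α β γ L y i) b with hT
  -- the first variation
  have FV : ∀ (i : Fin N) (η : ℝ → ℝ), ContDiff ℝ 1 η → η a = 0 →
      HasDerivAt (fun ε : ℝ => Jfun a b α β γ L (fun t => y t + ε • pert i η t))
        ((∫ x in a..b, E i x * η x) + η b * T i) 0 := by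
    intro i η hη ha
    have h := first_var habl hα1 hβ1 hL hy i hη
    rwa [frac_ibp habl hα1 hβ1 (cA i) (hC1 i) (cW i) (hRL i).1 (hRL i).2 hη ha] at h
  -- minimality along the variation
  have MV : ∀ (i : Fin N) (η : ℝ → ℝ), ContDiff ℝ 1 η → η a = 0 → (i = l ∨ η b = 0) →
      ∀ᶠ ε in nhds (0:ℝ), y b l + ε * (η b * (Pi.single i (1:ℝ) : Fin N → ℝ) l) ≤ ylb →
        Jfun a b α β γ L (fun t => y t + (0:ℝ) • pert i η t)
          ≤ Jfun a b α β γ L (fun t => y t + ε • pert i η t) := by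
    intro i η hη ha hb
    filter_upwards [norm1inf_small (γ := γ) habl hα1 hβ1 i hη hδ] with ε hε hle
    simp only [zero_smul, add_zero]
    refine hmin _ (MemD_var habl hα1 hβ1 hy i hη ε) ?_ ?_ ?_ ?_
    · simp [pert, ha, hya]
    · intro j hj
      rcases hb with rfl | hb
      · simp [pert, hj, hyb j hj]
      · simp [pert, hb, hyb j hj]
    · simpa [pert] using hle
    · convert hε using 2
      funext t; simp
  have EL : ∀ i, ∀ x ∈ Icc a b, E i x = 0 := by
    intro i
    have hz : ∀ η : ℝ → ℝ, ContDiff ℝ 1 η → η a = 0 → η b = 0 → ∫ x in a..b, E i x * η x = 0 := by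
      intro η hη ha hb
      have h1 := FV i η hη ha
      rw [hb, zero_mul, add_zero] at h1
      refine IsLocalMin.hasDerivAt_eq_zero ?_ h1
      filter_upwards [MV i η hη ha (Or.inr hb)] with ε h2
      exact h2 (by simpa [hb] using hylb)
    have hae : ∀ᵐ x, x ∈ Ioo a b → E i x = 0 := by
      refine isOpen_Ioo.ae_eq_zero_of_integral_contDiff_smul_eq_zero ?_ ?_
      · exact (((cE i).integrableOn_Icc).mono_set Ioo_subset_Icc_self).locallyIntegrableOn
      · intro η hη _ hs
        have hnot : ∀ x, x ∉ Ioo a b → η x = 0 := fun x hx =>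
          image_eq_zero_of_notMem_tsupport fun h => hx (hs h)
        rw [← hz η (hη.of_le (by exact_mod_cast le_top)) (hnot a (by simp)) (hnot b (by simp)),
          intervalIntegral.integral_of_le habl, ← integral_indicator measurableSet_Ioc]
        congr 1; funext x
        by_cases hx : x ∈ Ioc a b
        · rw [indicator_of_mem hx, smul_eq_mul, mul_comm]
        · rw [indicator_of_notMem hx, hnot x (fun h => hx ⟨h.1, h.2.le⟩), zero_smul]
    have hae2 : E i =ᵐ[volume.restrict (Icc a b)] fun _ => (0:ℝ) := by
      rw [← restrict_Ioo_eq_restrict_Icc]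
      exact (ae_restrict_iff' measurableSet_Ioo).2 hae
    exact Measure.eqOn_Icc_of_ae_eq volume hab.ne hae2 (cE i) continuousOn_const
  have hη1 : ContDiff ℝ 1 fun x : ℝ => (x - a) / (b - a) := by fun_prop
  have hηb : (b - a) / (b - a) = 1 := div_self (by linarith)
  have D := FV l _ hη1 (by simp)
  have M := MV l _ hη1 (by simp) (Or.inl rfl)
  have I0 : (∫ x in a..b, E l x * ((x - a) / (b - a))) = 0 := by
    rw [intervalIntegral.integral_congr (g := fun _ => (0:ℝ))]
    · simp
    · intro x hx
      rw [uIcc_of_le habl] at hx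
      simp [EL l x hx]
  simp only [I0, hηb, one_mul, zero_add, Pi.single_eq_same, mul_one] at D M
  refine ⟨EL, ?_, ?_⟩
  · refine deriv_nonpos_of_left D ?_
    filter_upwards [M] with ε h1 h2
    exact h1 (by linarith)
  · intro hlt
    refine IsLocalMin.hasDerivAt_eq_zero ?_ D
    have : ∀ᶠ ε in nhds (0:ℝ), ε < ylb - y b l := eventually_lt_nhds (by linarith)
    filter_upwards [M, this] with ε h1 h2
    exact h1 (by linarith)

end
end

section
/- Let a<b, 0<α<1, L ∈ C¹([a,b]×ℝ²;ℝ), and y_a ∈ ℝ. Suppose y:[a,b]→ℝ, with y' and ^C_aD_x^α y continuous on [a,b], satisfies y(a)=y_a and is a local minimizer of J(y) = ∫_a^b L(x, y(x), ^C_aD_x^α y(x)) dx among all such functions with y(a)=y_a (y(b) free), and assume that x ↦ ∂₃L(x, y(x), ^C_aD_x^α y(x)) admits a continuous right Riemann–Liouville derivative ₓD_b^α on [a,b]. Then ∂₂L(x, y(x), ^C_aD_x^α y(x)) + (ₓD_b^α ∂₃L(·, y(·), ^C_aD_x^α y(·)))(x) = 0 for all x ∈ [a,b], and moreover (ₓI_b^{1−α}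 ∂₃L(·, y(·), ^C_aD_x^α y(·)))(x) evaluated at x=b equals 0. -/
open MeasureTheory Set

noncomputable section

/-- `y'` and `^C_aD_x^α y` exist and are continuous on `[a,b]`. -/
def MemDs (a b α : ℝ) (y : ℝ → ℝ) : Prop :=
  (∀ x ∈ Icc a b, DifferentiableAt ℝ y x) ∧
  ContinuousOn (deriv y) (Icc a b) ∧ ContinuousOn (caputoL a α y) (Icc a b)

/-- The norm `‖y‖_{1,∞} = max |y| + max |y'| + max |^C_aD_x^α y|` on `[a,b]`. -/
def norm1infS (a b α : ℝ) (y : ℝ → ℝ) : ℝ :=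
  sSup ((fun x => |y x|) '' Icc a b) + sSup ((fun x => |deriv y x|) '' Icc a b) +
    sSup ((fun x => |caputoL a α y x|) '' Icc a b)

/-- `∂₂L` of a Lagrangian `L(x, y, w)`. -/
def d2 (L : ℝ → ℝ → ℝ → ℝ) (x u w : ℝ) : ℝ := deriv (fun s => L x s w) u

/-- `∂₃L` of a Lagrangian `L(x, y, w)`. -/
def d3 (L : ℝ → ℝ → ℝ → ℝ) (x u w : ℝ) : ℝ := deriv (fun s => L x u s) w

/-- `x ↦ ∂₃L(x, y(x), ^C_aD_x^α y(x))`. -/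
def d3Along (a α : ℝ) (L : ℝ → ℝ → ℝ → ℝ) (y : ℝ → ℝ) (x : ℝ) : ℝ :=
  d3 L x (y x) (caputoL a α y x)

lemma aux_frac_swap (a b α : ℝ) (hab : a < b) (hα0 : 0 < α) (hα1 : α < 1) (g k : ℝ → ℝ)
    (hg : ContinuousOn g (Icc a b)) (hk : ContinuousOn k (Icc a b)) :
    ∫ x in a..b, g x * ∫ t in a..x, (x - t) ^ (-α) * k t =
      ∫ t in a..b, k t * ∫ x in t..b, (x - t) ^ (-α) * g x := by
  set φ : ℝ → ℝ := (Ioc 0 (b - a)).indicator (fun s => s ^ (-α)) with hφ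
  set G : ℝ → ℝ := (Ioc a b).indicator g with hG
  set K : ℝ → ℝ := (Ioc a b).indicator k with hK
  have hφi : Integrable φ := by
    rw [hφ, integrable_indicator_iff measurableSet_Ioc]
    have := intervalIntegral.intervalIntegrable_rpow' (a := 0) (b := b - a) (r := -α) (by linarith)
    rwa [intervalIntegrable_iff, uIoc_of_le (by linarith)] at this
  have hsub : Ioc a b ⊆ Icc a b := Ioc_subset_Icc_self
  have hKi : Integrable K := by
    rw [hK, integrable_indicator_iff measurableSet_Ioc]
    exact (hk.integrableOn_Icc).mono_set hsub
  have hGi : Integrable G := by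
    rw [hG, integrable_indicator_iff measurableSet_Ioc]
    exact (hg.integrableOn_Icc).mono_set hsub
  obtain ⟨C, hC⟩ := isCompact_Icc.exists_bound_of_continuousOn hg
  have hGb : ∀ x, ‖G x‖ ≤ |C| := by
    intro x
    by_cases hx : x ∈ Ioc a b
    · rw [hG, indicator_of_mem hx]; exact (hC x (hsub hx)).trans (le_abs_self C)
    · rw [hG, indicator_of_notMem hx]; simp
  have h1 : Integrable (fun p : ℝ × ℝ => K p.2 * φ (p.1 - p.2)) (volume.prod volume) :=
    hKi.convolution_integrand (ContinuousLinearMap.mul ℝ ℝ) hφi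
  have h2 : Integrable (fun p : ℝ × ℝ => G p.1 * (K p.2 * φ (p.1 - p.2)))
      (volume.prod volume) := by
    refine h1.bdd_mul (c := |C|) ?_ (Filter.Eventually.of_forall fun p => hGb p.1)
    exact hGi.aestronglyMeasurable.comp_fst
  have h3 := integral_integral_swap (f := fun x t => G x * (K t * φ (x - t))) h2
  have key : ∀ x ∈ Ioc a b, ∀ t ∈ Ioc a b, φ (x - t) = if t ≤ x then (x - t) ^ (-α) else 0 := by
    intro x hx t ht
    rcases lt_trichotomy t x with h | h | h
    · rw [if_pos h.le, hφ, indicator_of_mem]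
      exact ⟨by linarith, by linarith [hx.2, ht.1]⟩
    · subst h
      rw [if_pos le_rfl, hφ, indicator_of_notMem (by simp), sub_self,
        Real.zero_rpow (by linarith)]
    · rw [if_neg (not_le.2 h), hφ, indicator_of_notMem]
      simp only [mem_Ioc, not_and]
      intro h'; linarith
  have hl : ∫ x in a..b, g x * ∫ t in a..x, (x - t) ^ (-α) * k t =
      ∫ x, ∫ t, G x * (K t * φ (x - t)) := by
    rw [intervalIntegral.integral_of_le hab.le, ← integral_indicator measurableSet_Ioc]
    congr 1
    ext x
    rw [integral_const_mul]
    by_cases hx : x ∈ Ioc a b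
    · rw [indicator_of_mem hx, hG, indicator_of_mem hx, intervalIntegral.integral_of_le hx.1.le,
        ← integral_indicator measurableSet_Ioc]
      congr 2
      ext t
      by_cases ht : t ∈ Ioc a b
      · rw [key x hx t ht, hK, indicator_of_mem ht]
        by_cases h : t ≤ x
        · rw [indicator_of_mem (show t ∈ Ioc a x from ⟨ht.1, h⟩), if_pos h]; ring
        · rw [indicator_of_notMem (fun h' => h h'.2), if_neg h]; ring
      · rw [hK, indicator_of_notMem ht, indicator_of_notMem (fun h' => ht ⟨h'.1, h'.2.trans hx.2⟩)]
        ring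
    · rw [indicator_of_notMem hx, hG, indicator_of_notMem hx, zero_mul]
  have hr : ∫ t in a..b, k t * ∫ x in t..b, (x - t) ^ (-α) * g x =
      ∫ t, ∫ x, G x * (K t * φ (x - t)) := by
    rw [intervalIntegral.integral_of_le hab.le, ← integral_indicator measurableSet_Ioc]
    congr 1
    ext t
    have : ∀ x, G x * (K t * φ (x - t)) = K t * (G x * φ (x - t)) := fun x => by ring
    simp_rw [this]
    rw [integral_const_mul]
    by_cases ht : t ∈ Ioc a b
    · rw [indicator_of_mem ht, hK, indicator_of_mem ht, intervalIntegral.integral_of_le ht.2,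
        ← integral_indicator measurableSet_Ioc]
      congr 2
      ext x
      by_cases hx : x ∈ Ioc a b
      · rw [key x hx t ht, hG, indicator_of_mem hx]
        rcases lt_trichotomy t x with h | h | h
        · rw [indicator_of_mem (show x ∈ Ioc t b from ⟨h, hx.2⟩), if_pos h.le]; ring
        · subst h
          rw [indicator_of_notMem (by simp), if_pos le_rfl, sub_self,
            Real.zero_rpow (by linarith), mul_zero]
        · rw [indicator_of_notMem (fun h' => (lt_asymm h h'.1)), if_neg (not_le.2 h)]; ring
      · rw [hG, indicator_of_notMem hx, indicator_of_notMem (fun h' => hx ⟨ht.1.trans h'.1, h'.2⟩)]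
        ring
    · rw [indicator_of_notMem ht, hK, indicator_of_notMem ht, zero_mul]
  rw [hl, hr, h3]

lemma aux_d2 (L : ℝ → ℝ → ℝ → ℝ)
    (hL : ContDiff ℝ 1 fun p : ℝ × ℝ × ℝ => L p.1 p.2.1 p.2.2) (x u w : ℝ) :
    d2 L x u w = fderiv ℝ (fun p : ℝ × ℝ × ℝ => L p.1 p.2.1 p.2.2) (x, u, w) (0, 1, 0) := by
  have h1 := (hL.differentiable one_ne_zero (x, u, w)).hasFDerivAt
  have h2 : HasDerivAt (fun s : ℝ => ((x, s, w) : ℝ × ℝ × ℝ)) (0, 1, 0) u :=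
    (hasDerivAt_const u x).prodMk ((hasDerivAt_id u).prodMk (hasDerivAt_const u w))
  exact (h1.comp_hasDerivAt u h2).deriv

lemma aux_d3 (L : ℝ → ℝ → ℝ → ℝ)
    (hL : ContDiff ℝ 1 fun p : ℝ × ℝ × ℝ => L p.1 p.2.1 p.2.2) (x u w : ℝ) :
    d3 L x u w = fderiv ℝ (fun p : ℝ × ℝ × ℝ => L p.1 p.2.1 p.2.2) (x, u, w) (0, 0, 1) := by
  have h1 := (hL.differentiable one_ne_zero (x, u, w)).hasFDerivAt
  have h2 : HasDerivAt (fun s : ℝ => ((x, u, s) : ℝ × ℝ × ℝ)) (0, 0, 1) w :=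
    (hasDerivAt_const w x).prodMk ((hasDerivAt_const w u).prodMk (hasDerivAt_id w))
  exact (h1.comp_hasDerivAt w h2).deriv

lemma aux_d2_cont (L : ℝ → ℝ → ℝ → ℝ)
    (hL : ContDiff ℝ 1 fun p : ℝ × ℝ × ℝ => L p.1 p.2.1 p.2.2) :
    Continuous (fun p : ℝ × ℝ × ℝ => d2 L p.1 p.2.1 p.2.2) := by
  simp_rw [aux_d2 L hL]
  exact (hL.continuous_fderiv one_ne_zero).clm_apply continuous_const

lemma aux_d3_cont (L : ℝ → ℝ → ℝ → ℝ)
    (hL : ContDiff ℝ 1 fun p : ℝ × ℝ × ℝ => L p.1 p.2.1 p.2.2) :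
    Continuous (fun p : ℝ × ℝ × ℝ => d3 L p.1 p.2.1 p.2.2) := by
  simp_rw [aux_d3 L hL]
  exact (hL.continuous_fderiv one_ne_zero).clm_apply continuous_const

lemma aux_first_var (a b : ℝ) (hab : a < b) (L : ℝ → ℝ → ℝ → ℝ)
    (hL : ContDiff ℝ 1 fun p : ℝ × ℝ × ℝ => L p.1 p.2.1 p.2.2) (y w h v : ℝ → ℝ)
    (hy : ContinuousOn y (Icc a b)) (hw : ContinuousOn w (Icc a b))
    (hh : ContinuousOn h (Icc a b)) (hv : ContinuousOn v (Icc a b)) :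
    HasDerivAt (fun ε : ℝ => ∫ x in a..b, L x (y x + ε * h x) (w x + ε * v x))
      (∫ x in a..b, (d2 L x (y x) (w x) * h x + d3 L x (y x) (w x) * v x)) 0 := by
  set F' : ℝ → ℝ → ℝ := fun ε x => d2 L x (y x + ε * h x) (w x + ε * v x) * h x +
    d3 L x (y x + ε * h x) (w x + ε * v x) * v x with hF'
  have hsub : Set.uIoc a b ⊆ Icc a b := by rw [uIoc_of_le hab.le]; exact Ioc_subset_Icc_self
  have hcurve : ContinuousOn (fun q : ℝ × ℝ =>
      ((q.2, y q.2 + q.1 * h q.2, w q.2 + q.1 * v q.2) : ℝ × ℝ × ℝ))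
      (Icc (-1) 1 ×ˢ Icc a b) := by
    have hm : MapsTo (fun q : ℝ × ℝ => q.2) (Icc (-1:ℝ) 1 ×ˢ Icc a b) (Icc a b) :=
      fun q hq => hq.2
    have e1 := hy.comp continuousOn_snd hm
    have e2 := hw.comp continuousOn_snd hm
    have e3 := hh.comp continuousOn_snd hm
    have e4 := hv.comp continuousOn_snd hm
    exact continuousOn_snd.prodMk ((e1.add (continuousOn_fst.mul e3)).prodMk
      (e2.add (continuousOn_fst.mul e4)))
  have hF'c : ContinuousOn (fun q : ℝ × ℝ => F' q.1 q.2) (Icc (-1) 1 ×ˢ Icc a b) := by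
    have hm : MapsTo (fun q : ℝ × ℝ => q.2) (Icc (-1:ℝ) 1 ×ˢ Icc a b) (Icc a b) :=
      fun q hq => hq.2
    have e3 := hh.comp continuousOn_snd hm
    have e4 := hv.comp continuousOn_snd hm
    exact (((aux_d2_cont L hL).comp_continuousOn hcurve).mul e3).add
      (((aux_d3_cont L hL).comp_continuousOn hcurve).mul e4)
  have hFc : ContinuousOn (fun q : ℝ × ℝ => L q.2 (y q.2 + q.1 * h q.2) (w q.2 + q.1 * v q.2))
      (Icc (-1) 1 ×ˢ Icc a b) := hL.continuous.comp_continuousOn hcurve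
  have slice : ∀ ε ∈ Icc (-1:ℝ) 1, ∀ f : ℝ × ℝ → ℝ, ContinuousOn f (Icc (-1) 1 ×ˢ Icc a b) →
      ContinuousOn (fun x => f (ε, x)) (Icc a b) := fun ε hε f hf =>
    hf.comp (by fun_prop) (fun x hx => ⟨hε, hx⟩)
  obtain ⟨C, hC⟩ := (isCompact_Icc.prod isCompact_Icc).exists_bound_of_continuousOn hF'c
  have h0 : (0:ℝ) ∈ Icc (-1:ℝ) 1 := by constructor <;> norm_num
  have hnh : Icc (-1:ℝ) 1 ∈ nhds (0:ℝ) := Icc_mem_nhds (by norm_num) (by norm_num)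
  have main := intervalIntegral.hasDerivAt_integral_of_dominated_loc_of_deriv_le
    (μ := volume) (a := a) (b := b) (x₀ := (0:ℝ)) (s := Icc (-1:ℝ) 1)
    (F := fun ε x => L x (y x + ε * h x) (w x + ε * v x)) (F' := F') (bound := fun _ => C)
    hnh ?_ ?_ ?_ ?_ (by simp) ?_
  · have := main.2
    simpa only [hF', zero_mul, add_zero] using this
  · filter_upwards [hnh] with ε hε
    exact ((slice ε hε _ hFc).mono hsub).aestronglyMeasurable measurableSet_uIoc
  · apply ContinuousOn.intervalIntegrable
    rw [uIcc_of_le hab.le]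
    exact slice 0 h0 _ hFc
  · exact ((slice 0 h0 _ hF'c).mono hsub).aestronglyMeasurable measurableSet_uIoc
  · exact Filter.Eventually.of_forall fun t ht ε hε => hC (ε, t) ⟨hε, hsub ht⟩
  · refine Filter.Eventually.of_forall fun t ht ε hε => ?_
    have h1 := (hL.differentiable one_ne_zero (t, y t + ε * h t, w t + ε * v t)).hasFDerivAt
    have h2 : HasDerivAt (fun s : ℝ => ((t, y t + s * h t, w t + s * v t) : ℝ × ℝ × ℝ))
        (0, h t, v t) ε := by
      refine (hasDerivAt_const ε t).prodMk (HasDerivAt.prodMk ?_ ?_)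
      · simpa using ((hasDerivAt_id ε).mul_const (h t)).const_add (y t)
      · simpa using ((hasDerivAt_id ε).mul_const (v t)).const_add (w t)
    have h3 := h1.comp_hasDerivAt ε h2
    refine h3.congr_deriv ?_
    simp only [hF', aux_d2 L hL, aux_d3 L hL]
    have : ((0, h t, v t) : ℝ × ℝ × ℝ) = h t • (0, 1, 0) + v t • (0, 0, 1) := by simp
    rw [this, map_add, map_smul, map_smul]
    simp [mul_comm]

lemma aux_caputo_cont (a b α : ℝ) (hab : a < b) (hα1 : α < 1) (h : ℝ → ℝ)
    (hc : Continuous (deriv h)) (hcs : HasCompactSupport (deriv h))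
    (hz : ∀ t ≤ a, deriv h t = 0) :
    ContinuousOn (caputoL a α h) (Icc a b) := by
  obtain ⟨C, hC⟩ := hc.bounded_above_of_compact_support hcs
  have hint := intervalIntegral.intervalIntegrable_rpow' (a := 0) (b := b - a) (r := -α)
    (by linarith)
  have h1 : Continuous fun x => ∫ s in (0:ℝ)..(b - a), s ^ (-α) * deriv h (x - s) := by
    refine intervalIntegral.continuous_of_dominated_interval (bound := fun s => ‖s ^ (-α)‖ * C)
      ?_ ?_ ?_ ?_
    · intro x
      exact (intervalIntegrable_iff.1 hint).aestronglyMeasurable.mul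
        (by fun_prop : Continuous fun s => deriv h (x - s)).aestronglyMeasurable
    · intro x
      refine Filter.Eventually.of_forall fun t _ => ?_
      rw [norm_mul]
      exact mul_le_mul_of_nonneg_left (hC _) (norm_nonneg _)
    · exact hint.norm.mul_const C
    · refine Filter.Eventually.of_forall fun t _ => ?_
      fun_prop
  refine ((continuous_const.mul h1 : Continuous fun x => (1 / Real.Gamma (1 - α)) * 
    ∫ s in (0:ℝ)..(b - a), s ^ (-α) * deriv h (x - s))).continuousOn.congr ?_
  intro x hx
  simp only [caputoL]
  congr 1
  have e1 : ∫ t in a..x, (x - t) ^ (-α) * deriv h t =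
      ∫ s in (0:ℝ)..(x - a), s ^ (-α) * deriv h (x - s) := by
    have := intervalIntegral.integral_comp_sub_left (a := a) (b := x)
      (fun s => s ^ (-α) * deriv h (x - s)) x
    simpa using this
  have I : ∀ p q, IntervalIntegrable (fun s => s ^ (-α) * deriv h (x - s)) volume p q := by
    intro p q
    exact (intervalIntegral.intervalIntegrable_rpow' (by linarith)).mul_continuousOn
      (by fun_prop)
  beta_reduce
  rw [e1, ← intervalIntegral.integral_add_adjacent_intervals (I 0 (x - a)) (I (x - a) (b - a))]
  have : ∫ s in (x - a)..(b - a), s ^ (-α) * deriv h (x - s) = 0 := by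
    rw [intervalIntegral.integral_of_le (by linarith [hx.2])]
    refine setIntegral_eq_zero_of_forall_eq_zero fun s hs => ?_
    rw [hz _ (by linarith [hs.1]), mul_zero]
  rw [this, add_zero]

lemma aux_caputo_smul (a α ε : ℝ) (h : ℝ → ℝ) (hd : Differentiable ℝ h) (x : ℝ) :
    caputoL a α (fun x => ε * h x) x = ε * caputoL a α h x := by
  simp only [caputoL]
  have : deriv (fun x => ε * h x) = fun x => ε * deriv h x := by
    ext t; exact deriv_const_mul _ (hd t)
  rw [this]
  have : ∀ t, (x - t) ^ (-α) * (ε * deriv h t) = ε * ((x - t) ^ (-α) * deriv h t) :=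
    fun t => by ring
  simp_rw [this]
  rw [intervalIntegral.integral_const_mul]
  ring

lemma aux_int (a b α : ℝ) (hα1 : α < 1) (k : ℝ → ℝ) (hk : ContinuousOn k (Icc a b))
    (x : ℝ) (hx : x ∈ Icc a b) :
    IntervalIntegrable (fun t => (x - t) ^ (-α) * k t) volume a x := by
  have h0 := intervalIntegral.intervalIntegrable_rpow' (a := x - a) (b := 0) (r := -α)
    (by linarith)
  have h1 := h0.comp_sub_left x
  simp only [sub_sub_cancel, sub_zero] at h1
  refine h1.mul_continuousOn (hk.mono ?_)
  rw [uIcc_of_le hx.1]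
  exact Icc_subset_Icc_right hx.2

lemma aux_caputo_add (a b α ε : ℝ) (hα1 : α < 1) (y h : ℝ → ℝ)
    (hy : MemDs a b α y) (hd : Differentiable ℝ h) (hc : Continuous (deriv h))
    (x : ℝ) (hx : x ∈ Icc a b) :
    caputoL a α (fun x => y x + ε * h x) x = caputoL a α y x + ε * caputoL a α h x := by
  rw [← aux_caputo_smul a α ε h hd]
  simp only [caputoL]
  rw [← mul_add, ← intervalIntegral.integral_add]
  · congr 1
    refine intervalIntegral.integral_congr fun t ht => ?_
    rw [uIcc_of_le hx.1] at ht
    beta_reduce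
    rw [deriv_fun_add (hy.1 t ⟨ht.1, ht.2.trans hx.2⟩) ((hd t).const_mul ε)]
    ring
  · exact aux_int a b α hα1 _ hy.2.1 x hx
  · refine aux_int a b α hα1 _ ?_ x hx
    have : deriv (fun x => ε * h x) = fun x => ε * deriv h x := by
      ext t; exact deriv_const_mul _ (hd t)
    rw [this]
    fun_prop

lemma aux_sup (a b ε M : ℝ) (hab : a < b) (f : ℝ → ℝ) (hM : ∀ x ∈ Icc a b, ‖f x‖ ≤ M) :
    sSup ((fun x => |ε * f x|) '' Icc a b) ≤ |ε| * M := by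
  refine csSup_le ((nonempty_Icc.2 hab.le).image _) ?_
  rintro _ ⟨x, hx, rfl⟩
  simp only [abs_mul]
  exact mul_le_mul_of_nonneg_left (hM x hx) (abs_nonneg _)

lemma aux_weak
    (a b α : ℝ) (hab : a < b) (hα0 : 0 < α) (hα1 : α < 1)
    (L : ℝ → ℝ → ℝ → ℝ)
    (hL : ContDiff ℝ 1 fun p : ℝ × ℝ × ℝ => L p.1 p.2.1 p.2.2)
    (ya : ℝ) (y : ℝ → ℝ)
    (hy : MemDs a b α y) (hya : y a = ya)
    (hmin : ∃ δ > (0:ℝ), ∀ z : ℝ → ℝ, MemDs a b α z → z a = ya →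
      norm1infS a b α (fun x => z x - y x) < δ →
        (∫ x in a..b, L x (y x) (caputoL a α y x)) ≤ ∫ x in a..b, L x (z x) (caputoL a α z x))
    (h : ℝ → ℝ) (hh : ContDiff ℝ 1 h) (hcs : HasCompactSupport h)
    (hz : ∀ t ≤ a, deriv h t = 0) (ha : h a = 0) :
    ∫ x in a..b, (d2 L x (y x) (caputoL a α y x) * h x +
      d3 L x (y x) (caputoL a α y x) * caputoL a α h x) = 0 := by
  have hd : Differentiable ℝ h := hh.differentiable one_ne_zero
  have hc : Continuous (deriv h) := hh.continuous_deriv le_rfl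
  have hDh := aux_caputo_cont a b α hab hα1 h hc hcs.deriv hz
  have hyc : ContinuousOn y (Icc a b) := fun x hx => (hy.1 x hx).continuousAt.continuousWithinAt
  have hder := aux_first_var a b hab L hL y (caputoL a α y) h (caputoL a α h) hyc hy.2.2
    hd.continuous.continuousOn hDh
  refine IsLocalMin.hasDerivAt_eq_zero ?_ hder
  obtain ⟨δ, hδ, hm⟩ := hmin
  obtain ⟨M1, hM1⟩ := isCompact_Icc.exists_bound_of_continuousOn
    (hd.continuous.continuousOn (s := Icc a b))
  obtain ⟨M2, hM2⟩ := isCompact_Icc.exists_bound_of_continuousOn (hc.continuousOn (s := Icc a b))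
  obtain ⟨M3, hM3⟩ := isCompact_Icc.exists_bound_of_continuousOn hDh
  have hev : ∀ᶠ ε : ℝ in nhds 0, |ε| * M1 + |ε| * M2 + |ε| * M3 < δ := by
    have : Continuous fun ε : ℝ => |ε| * M1 + |ε| * M2 + |ε| * M3 := by fun_prop
    exact this.continuousAt.eventually_lt continuousAt_const (by simpa using hδ)
  filter_upwards [hev] with ε hε
  have hdε : deriv (fun x => ε * h x) = fun x => ε * deriv h x := by
    ext t; exact deriv_const_mul _ (hd t)
  have := hm (fun x => y x + ε * h x) ⟨?_, ?_, ?_⟩ (by simp [ha, hya]) ?_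
  · simp only [zero_mul, add_zero]
    refine this.trans (le_of_eq ?_)
    refine intervalIntegral.integral_congr fun t ht => ?_
    rw [uIcc_of_le hab.le] at ht
    beta_reduce
    rw [aux_caputo_add a b α ε hα1 y h hy hd hc t ht]
  · exact fun x hx => (hy.1 x hx).add ((hd x).const_mul ε)
  · refine (hy.2.1.add ((continuous_const.mul hc : Continuous fun x => ε * deriv h x).continuousOn)).congr
      fun x hx => ?_
    rw [deriv_fun_add (hy.1 x hx) ((hd x).const_mul ε), hdε]
    rfl
  · refine (hy.2.2.add (continuousOn_const.mul hDh : ContinuousOn (fun x => ε * caputoL a α h x)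
      (Icc a b))).congr fun x hx => ?_
    exact aux_caputo_add a b α ε hα1 y h hy hd hc x hx
  · refine lt_of_le_of_lt ?_ hε
    simp only [add_sub_cancel_left, norm1infS, hdε]
    have e : caputoL a α (fun x => ε * h x) = fun x => ε * caputoL a α h x := by
      ext x; exact aux_caputo_smul a α ε h hd x
    rw [e]
    exact add_le_add (add_le_add (aux_sup a b ε M1 hab _ hM1) (aux_sup a b ε M2 hab _ hM2))
      (aux_sup a b ε M3 hab _ hM3)

/-- Agrawal's theorem: a local minimizer of `J(y) = ∫_a^b L(x, y(x), ^C_aD_x^α y(x)) dx`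
with `y(a) = y_a` fixed and `y(b)` free satisfies the Caputo Euler–Lagrange equation
`∂₂L + ₓD_b^α ∂₃L = 0` together with the natural boundary condition
`(ₓI_b^{1−α} ∂₃L)(b) = 0`. -/
theorem euler_lagrange_caputo_natural_boundary
    (a b α : ℝ) (hab : a < b) (hα0 : 0 < α) (hα1 : α < 1)
    (L : ℝ → ℝ → ℝ → ℝ)
    (hL : ContDiff ℝ 1 fun p : ℝ × ℝ × ℝ => L p.1 p.2.1 p.2.2)
    (ya : ℝ) (y : ℝ → ℝ)
    (hy : MemDs a b α y) (hya : y a = ya)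
    (hmin : ∃ δ > (0:ℝ), ∀ z : ℝ → ℝ, MemDs a b α z → z a = ya →
      norm1infS a b α (fun x => z x - y x) < δ →
        (∫ x in a..b, L x (y x) (caputoL a α y x)) ≤ ∫ x in a..b, L x (z x) (caputoL a α z x))
    (hRL : HasContRightRLD a b α (d3Along a α L y)) :
    (∀ x ∈ Icc a b,
      d2 L x (y x) (caputoL a α y x) + rightRLD b α (d3Along a α L y) x = 0) ∧
    rightRLI b (1 - α) (d3Along a α L y) b = 0 := by
  refine ⟨?_, by simp [rightRLI]⟩
  have hyc : ContinuousOn y (Icc a b) := fun x hx => (hy.1 x hx).continuousAt.continuousWithinAt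
  have hcurve : ContinuousOn (fun x => ((x, y x, caputoL a α y x) : ℝ × ℝ × ℝ)) (Icc a b) :=
    continuousOn_id.prodMk (hyc.prodMk hy.2.2)
  have hp : ContinuousOn (fun x => d2 L x (y x) (caputoL a α y x)) (Icc a b) :=
    (aux_d2_cont L hL).comp_continuousOn hcurve
  have hg : ContinuousOn (d3Along a α L y) (Icc a b) :=
    (aux_d3_cont L hL).comp_continuousOn hcurve
  set g := d3Along a α L y with hgdef
  set c : ℝ := 1 / Real.Gamma (1 - α) with hc
  have hΓ : 0 < Real.Gamma (1 - α) := Real.Gamma_pos_of_pos (by linarith)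
  set G : ℝ → ℝ := fun s => ∫ t in s..b, (t - s) ^ (-α) * g t with hG
  have hR : ∀ x, rightRLD b α g x = -c * deriv G x := by
    intro x; simp only [rightRLD, hc, hG]; ring
  have hG' : ContinuousOn (deriv G) (Icc a b) := by
    refine (continuousOn_const.mul hRL.2 : ContinuousOn
      (fun x => -Real.Gamma (1 - α) * rightRLD b α g x) (Icc a b)).congr fun x _ => ?_
    change deriv G x = -Real.Gamma (1 - α) * rightRLD b α g x
    rw [hR, hc]
    field_simp
  set f : ℝ → ℝ := fun x => d2 L x (y x) (caputoL a α y x) + rightRLD b α g x with hf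
  have hfc : ContinuousOn f (Icc a b) := hp.add hRL.2
  have hae : ∀ᵐ x ∂volume, x ∈ Ioo a b → f x = 0 := by
    refine isOpen_Ioo.ae_eq_zero_of_integral_contDiff_smul_eq_zero
      ((hfc.mono Ioo_subset_Icc_self).locallyIntegrableOn measurableSet_Ioo) ?_
    intro h hh hcs hts
    have hh1 : ContDiff ℝ 1 h := hh.of_le (by exact_mod_cast le_top)
    have hd : Differentiable ℝ h := hh1.differentiable one_ne_zero
    have hdc : Continuous (deriv h) := hh1.continuous_deriv le_rfl
    have hz : ∀ t, t ∉ Ioo a b → h t = 0 := fun t ht =>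
      image_eq_zero_of_notMem_tsupport (fun h' => ht (hts h'))
    have hz' : ∀ t ≤ a, deriv h t = 0 := fun t ht => by
      by_contra hne
      have := hts (support_deriv_subset hne)
      linarith [this.1]
    have ha : h a = 0 := hz a (by simp)
    have hw := aux_weak a b α hab hα0 hα1 L hL ya y hy hya hmin h hh1 hcs hz' ha
    have hDh := aux_caputo_cont a b α hab hα1 h hdc hcs.deriv hz'
    have II : ∀ k : ℝ → ℝ, ContinuousOn k (Icc a b) → IntervalIntegrable k volume a b :=
      fun k hk => ContinuousOn.intervalIntegrable (by rwa [uIcc_of_le hab.le])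
    have hsw := aux_frac_swap a b α hab hα0 hα1 g (deriv h) hg hdc.continuousOn
    have hpart := intervalIntegral.integral_mul_deriv_eq_deriv_mul (a := a) (b := b) (u := G)
      (v := h) (u' := deriv G) (v' := deriv h)
      (fun x hx => (hRL.1 x (by rwa [uIcc_of_le hab.le] at hx)).hasDerivAt)
      (fun x _ => (hd x).hasDerivAt) (II _ hG') (II _ hdc.continuousOn)
    have hGb : G b = 0 := by simp [hG]
    rw [hGb, ha, zero_mul, mul_zero, sub_zero, zero_sub] at hpart
    have hcap : ∫ x in a..b, g x * caputoL a α h x = ∫ x in a..b, rightRLD b α g x * h x := by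
      have e1 : ∀ x, g x * caputoL a α h x =
          c * (g x * ∫ t in a..x, (x - t) ^ (-α) * deriv h t) := fun x => by
        simp only [caputoL, hc]; ring
      have e2 : ∀ x, rightRLD b α g x * h x = -c * (deriv G x * h x) := fun x => by
        rw [hR]; ring
      have e3 : ∀ t, deriv h t * (∫ x in t..b, (x - t) ^ (-α) * g x) = G t * deriv h t :=
        fun t => by simp only [hG]; ring
      simp_rw [e1, e2]
      rw [intervalIntegral.integral_const_mul, intervalIntegral.integral_const_mul, hsw]
      simp_rw [e3]
      rw [hpart]; ring
    have hhc := hd.continuous.continuousOn (s := Icc a b)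
    have i1 : IntervalIntegrable (fun x => d2 L x (y x) (caputoL a α y x) * h x) volume a b :=
      II _ (hp.mul hhc)
    have i2 : IntervalIntegrable (fun x => d3 L x (y x) (caputoL a α y x) * caputoL a α h x)
      volume a b := II _ (hg.mul hDh)
    have i3 : IntervalIntegrable (fun x => rightRLD b α g x * h x) volume a b :=
      II _ (hRL.2.mul hhc)
    rw [intervalIntegral.integral_add i1 i2] at hw
    have hw2 : (∫ x in a..b, d2 L x (y x) (caputoL a α y x) * h x) +
        ∫ x in a..b, rightRLD b α g x * h x = 0 := by rw [← hcap]; exact hw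
    rw [← intervalIntegral.integral_add i1 i3] at hw2
    rw [← hw2, intervalIntegral.integral_of_le hab.le]
    rw [← integral_indicator measurableSet_Ioc]
    congr 1
    ext x
    by_cases hx : x ∈ Ioc a b
    · rw [indicator_of_mem hx]; simp only [hf, smul_eq_mul]; ring
    · rw [indicator_of_notMem hx, hz x (fun h' => hx ⟨h'.1, h'.2.le⟩), zero_smul]
  have hae2 : f =ᵐ[volume.restrict (Icc a b)] (fun _ => (0:ℝ)) := by
    rw [← restrict_Ioo_eq_restrict_Icc]
    exact (ae_restrict_iff' measurableSet_Ioo).2 hae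
  exact fun x hx => Measure.eqOn_Icc_of_ae_eq volume hab.ne hae2 hfc continuousOn_const hx

end
end
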